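/- Let n ≥ 1 and let f be a nonnegative integrable function on ℝ^n. If T_θ f = f − (∫ f dx)·θ belongs to H_log(ℝ^n) (i.e., ∫_{ℝ^n} Ψ(x, 𝓜_φ(T_θ f)(x)) dx < ∞ for every smooth φ supported in the closed unit ball with ∫φ = 1), then ∫_{ℝ^n} f(x) ( 1 + ln₊ ln(e+f(x)) + ln₊ ln(e+|x|) ) dx < ∞. -/

import Mathlib

open MeasureTheory Real Set Metric ENNReal

noncomputable section

/-- `ℝ^n` with the Euclidean norm. -/
abbrev En (n : ℕ) := EuclideanSpace ℝ (Fin n)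

/-- `ln₊ t = max (ln t) 0`. -/
def lnp (t : ℝ) : ℝ := max (Real.log t) 0

/-- The unit cube `Q = (-1/2, 1/2)^n`. -/
def unitQ (n : ℕ) : Set (En n) := {x | ∀ i, -(1/2 : ℝ) < x i ∧ x i < 1/2}

/-- The dilate `φ_t(y) = t^{-n} φ(y/t)` convolved with `f` at `x`:
`(φ_t ∗ f)(x) = ∫ t^{-n} φ((x-y)/t) f(y) dy`. -/
def phiConv (n : ℕ) (φ f : En n → ℝ) (t : ℝ) (x : En n) : ℝ :=
  ∫ y, (t ^ n)⁻¹ * φ (t⁻¹ • (x - y)) * f y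

/-- The maximal function `𝓜_φ f(x) = sup_{t>0} |(φ_t ∗ f)(x)|`. -/
def Mphi (n : ℕ) (φ f : En n → ℝ) (x : En n) : ℝ :=
  ⨆ t : {t : ℝ // 0 < t}, |phiConv n φ f t.1 x|

/-- A smooth function supported in the closed unit ball with integral `1`. -/
def IsTestFun (n : ℕ) (φ : En n → ℝ) : Prop :=
  ContDiff ℝ (⊤ : ℕ∞) φ ∧ (∀ x, x ∉ Metric.closedBall (0 : En n) 1 → φ x = 0) ∧ (∫ x, φ x) = 1

/-- Membership in the Hardy space `H^1(ℝ^n)`: the maximal function `𝓜_φ f` is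
integrable for every admissible `φ`. -/
def MemH1 (n : ℕ) (f : En n → ℝ) : Prop :=
  ∀ φ : En n → ℝ, IsTestFun n φ → Integrable (Mphi n φ f)

/-- The Musielak function `Ψ(x,t) = t / (ln(e+t) + ln(e+|x|))` defining `L_log`. -/
def Psi (n : ℕ) (x : En n) (t : ℝ) : ℝ :=
  t / (Real.log (Real.exp 1 + t) + Real.log (Real.exp 1 + ‖x‖))


lemma aux_log_pow (m : ℕ) : Real.log (Real.exp 1 + 2 ^ m) ≤ m + 2 := by
  have h1 : Real.exp 1 + 2 ^ m ≤ Real.exp 1 ^ (m + 2) := by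
    have h2 : (2 : ℝ) ≤ Real.exp 1 := by have := Real.add_one_le_exp (1:ℝ); linarith
    have h3 : Real.exp 1 ≤ 3 := by have := Real.exp_one_lt_d9; linarith
    have h4 : (2:ℝ) ^ (m+2) ≤ Real.exp 1 ^ (m+2) := by gcongr
    have h5 : (1:ℝ) ≤ 2 ^ m := one_le_pow₀ (by norm_num)
    rw [pow_add] at h4
    linarith
  calc Real.log (Real.exp 1 + 2 ^ m) ≤ Real.log (Real.exp 1 ^ (m + 2)) :=
        Real.log_le_log (by positivity) h1
    _ = m + 2 := by rw [Real.log_pow, Real.log_exp]; push_cast; ring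

lemma aux_one_le_log {s : ℝ} (hs : 0 ≤ s) : 1 ≤ Real.log (Real.exp 1 + s) := by
  rw [Real.le_log_iff_exp_le (by positivity)]; linarith

lemma aux_psi_mono (n : ℕ) (x : En n) {s t : ℝ} (hs : 0 ≤ s) (hst : s ≤ t) :
    Psi n x s ≤ Psi n x t := by
  unfold Psi
  have h1 := aux_one_le_log hs
  have h2 := aux_one_le_log (hs.trans hst)
  have h3 := aux_one_le_log (norm_nonneg x)
  have ht := hs.trans hst
  rw [div_le_div_iff₀ (by linarith) (by linarith)]
  have he := Real.exp_pos 1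
  have h4 : Real.log (Real.exp 1 + t) - Real.log (Real.exp 1 + s) ≤ (t - s) / (Real.exp 1 + s) := by
    rw [← Real.log_div (by positivity) (by positivity)]
    refine (Real.log_le_sub_one_of_pos (by positivity)).trans (le_of_eq ?_)
    field_simp; ring
  have h5 : s * (Real.log (Real.exp 1 + t) - Real.log (Real.exp 1 + s)) ≤ t - s := by
    calc _ ≤ s * ((t - s) / (Real.exp 1 + s)) := by gcongr
      _ = (t - s) * (s / (Real.exp 1 + s)) := by ring
      _ ≤ (t - s) * 1 := by
          apply mul_le_mul_of_nonneg_left _ (by linarith)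
          rw [div_le_one (by positivity)]; linarith
      _ = t - s := by ring
  nlinarith [mul_nonneg (sub_nonneg.2 hst) (sub_nonneg.2 h1), mul_nonneg (sub_nonneg.2 hst) (sub_nonneg.2 h3)]

lemma aux_geom (K : ℕ) : ∑ k ∈ Finset.range (K+1), (2:ℝ)^k / (k+1) ≤ 4 * 2^K / (K+1) := by
  induction K with
  | zero => norm_num
  | succ K ih =>
    rw [Finset.sum_range_succ]
    rcases Nat.eq_zero_or_pos K with rfl | hK
    · norm_num
    · refine (add_le_add_left ih _).trans ?_
      have : (1:ℝ) ≤ K := by exact_mod_cast hK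
      push_cast
      rw [pow_succ, div_add_div _ _ (by positivity) (by positivity), div_le_div_iff₀ (by positivity) (by positivity)]
      have h2 : (0:ℝ) < 2^K := by positivity
      have : 0 ≤ (2:ℝ)^K * ((K-1) * (K+1+1)) := by
        apply mul_nonneg h2.le; apply mul_nonneg <;> linarith
      nlinarith

/-- the weight sum -/
def Wsum (N : ℕ) (s : ℝ) : ℝ≥0∞ :=
  ∑' k : ℕ, (if (2:ℝ)^(k+N) < s then ENNReal.ofReal (1/((k:ℝ)+1)) else 0)

lemma aux_loglog (N : ℕ) (s : ℝ) (hs : 0 ≤ s) :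
    ENNReal.ofReal (lnp (Real.log (Real.exp 1 + s))) ≤
      ENNReal.ofReal (Real.log (N+2)) + Wsum N s := by
  classical
  have hex : ∃ K : ℕ, s ≤ (2:ℝ)^(K+N) := by
    obtain ⟨K, hK⟩ := pow_unbounded_of_one_lt s (one_lt_two)
    exact ⟨K, hK.le.trans (pow_le_pow_right₀ (by norm_num) (by omega))⟩
  set K := Nat.find hex with hKdef
  have hK : s ≤ (2:ℝ)^(K+N) := Nat.find_spec hex
  have hk : ∀ k < K, (2:ℝ)^(k+N) < s := fun k hk => not_le.1 (Nat.find_min hex hk)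
  have h1 : ENNReal.ofReal (Real.log (K+1)) ≤ Wsum N s := by
    unfold Wsum
    refine le_trans ?_ (ENNReal.sum_le_tsum (Finset.range K))
    rw [Finset.sum_congr rfl (fun k hk' => if_pos (hk k (Finset.mem_range.1 hk')))]
    rw [← ENNReal.ofReal_sum_of_nonneg (fun k _ => by positivity)]
    apply ENNReal.ofReal_le_ofReal
    have := log_add_one_le_harmonic K
    simpa [harmonic] using this
  refine le_trans ?_ (add_le_add_right h1 _)
  have hN : 0 ≤ Real.log ((N:ℝ)+2) := Real.log_nonneg (by have := Nat.cast_nonneg (α := ℝ) N; linarith)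
  have hK0 : 0 ≤ Real.log ((K:ℝ)+1) := Real.log_nonneg (by have := Nat.cast_nonneg (α := ℝ) K; linarith)
  rw [← ENNReal.ofReal_add hN hK0]
  apply ENNReal.ofReal_le_ofReal
  unfold lnp
  apply max_le _ (by positivity)
  rw [← Real.log_mul (by positivity) (by positivity)]
  have h2 := aux_one_le_log hs
  apply Real.log_le_log (by linarith)
  calc _ ≤ Real.log (Real.exp 1 + 2^(K+N)) := Real.log_le_log (by positivity) (by linarith)
    _ ≤ _ := aux_log_pow _
    _ ≤ _ := by push_cast; nlinarith [Nat.cast_nonneg (α := ℝ) N, Nat.cast_nonneg (α := ℝ) K, mul_nonneg (Nat.cast_nonneg (α := ℝ) N) (Nat.cast_nonneg (α := ℝ) K)]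

/-- good bump -/
structure GoodPhi (n : ℕ) (φ : En n → ℝ) (a : ℝ) : Prop where
  test : IsTestFun n φ
  pos : 0 < a
  nonneg : ∀ x, 0 ≤ φ x
  le : ∀ x, φ x ≤ a
  eq : ∀ x, ‖x‖ ≤ 1/2 → φ x = a
  zero : ∀ x, 1 < ‖x‖ → φ x = 0

lemma exists_good (n : ℕ) : ∃ φ a, GoodPhi n φ a := by
  let b : ContDiffBump (0 : En n) := ⟨1/2, 1, by norm_num, by norm_num⟩
  have hz : ∀ x : En n, 1 < ‖x‖ → b.normed volume x = 0 := fun x hx => by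
    simp only [ContDiffBump.normed]
    rw [b.zero_of_le_dist (by simpa [b] using hx.le)]; simp
  have hpos : 0 < ∫ x, b x := b.integral_pos
  refine ⟨b.normed volume, 1 / ∫ x, b x, ⟨b.contDiff_normed, fun x hx => hz x (by simpa using hx), b.integral_normed⟩, by positivity, b.nonneg_normed, ?_, ?_, hz⟩
  · intro x
    simp only [ContDiffBump.normed]
    gcongr
    exact b.le_one
  · intro x hx
    simp only [ContDiffBump.normed]
    rw [b.one_of_mem_closedBall (by simpa [b] using hx)]

lemma vol_cb (n : ℕ) (x : En n) {r : ℝ} (hr : 0 ≤ r) :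
    volume.real (closedBall x r) = r ^ n * volume.real (ball (0 : En n) 1) := by
  simpa using Measure.addHaar_real_closedBall volume x hr

lemma v_pos (n : ℕ) : 0 < volume.real (ball (0 : En n) 1) := by
  rw [Measure.real]
  exact ENNReal.toReal_pos (measure_ball_pos _ _ one_pos).ne' measure_ball_lt_top.ne

lemma GoodPhi.integrable {n : ℕ} {φ : En n → ℝ} {a : ℝ} (h : GoodPhi n φ a) {g : En n → ℝ}
    (hg : Integrable g) (t : ℝ) (x : En n) :
    Integrable (fun y => φ (t⁻¹ • (x - y)) * g y) := by
  have hc : Continuous φ := h.test.1.continuous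
  refine hg.bdd_mul (c := a) (Continuous.aestronglyMeasurable (by fun_prop)) ?_
  filter_upwards with y
  rw [Real.norm_eq_abs, abs_of_nonneg (h.nonneg _)]
  exact h.le _

lemma phiConv_eq {n : ℕ} (φ g : En n → ℝ) (t : ℝ) (x : En n) :
    phiConv n φ g t x = (t^n)⁻¹ * ∫ y, φ (t⁻¹ • (x - y)) * g y := by
  unfold phiConv
  rw [← integral_const_mul]
  simp only [mul_assoc]

lemma GoodPhi.abs_le {n : ℕ} {φ : En n → ℝ} {a : ℝ} (h : GoodPhi n φ a) {g : En n → ℝ}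
    (hg : Integrable g) {t : ℝ} (ht : 0 < t) (x : En n) :
    |phiConv n φ g t x| ≤ (t^n)⁻¹ * (a * ∫ y in closedBall x t, |g y|) := by
  rw [phiConv_eq, abs_mul, abs_of_pos (by positivity : 0 < (t^n)⁻¹)]
  gcongr
  rw [← integral_const_mul, ← integral_indicator measurableSet_closedBall, ← Real.norm_eq_abs]
  apply norm_integral_le_of_norm_le
  · rw [integrable_indicator_iff measurableSet_closedBall]
    exact (hg.abs.const_mul a).integrableOn
  · filter_upwards with y
    by_cases hy : y ∈ closedBall x t
    · rw [indicator_of_mem hy, norm_mul, Real.norm_eq_abs, Real.norm_eq_abs, abs_of_nonneg (h.nonneg _)]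
      gcongr
      exact h.le _
    · rw [indicator_of_notMem hy, h.zero]
      · simp
      · rw [mem_closedBall, not_le, dist_comm, dist_eq_norm] at hy
        rw [norm_smul, norm_inv, Real.norm_eq_abs, abs_of_pos ht, inv_mul_eq_div, one_lt_div ht]
        exact hy

lemma GoodPhi.bdd {n : ℕ} {φ : En n → ℝ} {a : ℝ} (h : GoodPhi n φ a) {g : En n → ℝ}
    (hg : Integrable g) :
    ∀ᵐ x : En n, BddAbove (range fun t : {t : ℝ // 0 < t} => |phiConv n φ g t.1 x|) := by
  have ha := h.pos
  filter_upwards [IsUnifLocDoublingMeasure.ae_tendsto_average volume hg.abs.locallyIntegrable 1] with x hx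
  have h1 := hx (l := nhdsWithin 0 (Ioi 0)) (fun _ => x) (fun t : ℝ => t) Filter.tendsto_id
    (by filter_upwards [self_mem_nhdsWithin] with t ht
        have : (0:ℝ) < t := ht
        simp [this.le])
  have h2 := h1.eventually (gt_mem_nhds (lt_add_one _))
  rw [eventually_nhdsWithin_iff, Metric.eventually_nhds_iff] at h2
  obtain ⟨δ, hδ, h2⟩ := h2
  set v := volume.real (ball (0 : En n) 1) with hv
  have hvp : 0 < v := v_pos n
  have hI : 0 ≤ ∫ y, |g y| := integral_nonneg fun _ => abs_nonneg _
  refine ⟨max (a * v * (|g x| + 1)) ((δ^n)⁻¹ * (a * ∫ y, |g y|)), ?_⟩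
  rintro _ ⟨⟨t, ht⟩, rfl⟩
  refine (h.abs_le hg ht x).trans ?_
  by_cases htd : t < δ
  · apply le_max_of_le_left
    have h3 := h2 (y := t) (by simpa [abs_of_pos ht] using htd) ht
    rw [setAverage_eq, vol_cb n x ht.le, smul_eq_mul, inv_mul_eq_div, div_lt_iff₀ (by positivity)] at h3
    rw [inv_mul_le_iff₀ (by positivity)]
    have := mul_le_mul_of_nonneg_left h3.le ha.le
    refine this.trans (le_of_eq ?_)
    rw [← hv]; ring
  · apply le_max_of_le_right
    push Not at htd
    gcongr
    · exact Filter.Eventually.of_forall fun _ => abs_nonneg _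
    · exact hg.abs
    · exact Measure.restrict_le_self

lemma stop_lemma {n : ℕ} {f : En n → ℝ} (hf : Integrable f) (hf0 : ∀ x, 0 ≤ f x) {l : ℝ} (hl : 0 < l)
    (hbig : ∫ x, f x < l * volume.real (ball (0 : En n) 1)) :
    ∃ E : Set (En n), MeasurableSet E ∧
      ∫⁻ y in {y | l < f y ∧ 2 + ‖y‖ < l}, ENNReal.ofReal (f y) ≤ ENNReal.ofReal (5^n * l) * volume E ∧
      ∀ x ∈ E, ‖x‖ ≤ l ∧ ∃ r > 0, ∃ y, x ∈ closedBall y r ∧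
        l * (r^n * volume.real (ball (0 : En n) 1)) ≤ ∫ z in closedBall y r, f z := by
  classical
  set v := volume.real (ball (0 : En n) 1) with hv
  have hvp : 0 < v := v_pos n
  set A : Set (En n) := {y | l < f y ∧ 2 + ‖y‖ < l} with hA
  let S : En n → Set ℝ := fun y => {r | 0 < r ∧ l * (r^n * v) < ∫ z in closedBall y r, f z}
  have hS1 : ∀ y, ∀ r ∈ S y, r ≤ 1 := by
    intro y r ⟨hr, hr2⟩
    by_contra! hcon
    have h1 : ∫ z in closedBall y r, f z ≤ ∫ z, f z :=
      setIntegral_le_integral hf (Filter.Eventually.of_forall hf0)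
    have h2 : 1 ≤ r^n := one_le_pow₀ hcon.le
    have h3 : l * v ≤ l * (r^n * v) := by
      apply mul_le_mul_of_nonneg_left _ hl.le
      nlinarith
    linarith
  have hgood : ∀ᵐ y : En n, y ∈ A → (S y).Nonempty := by
    filter_upwards [IsUnifLocDoublingMeasure.ae_tendsto_average volume hf.locallyIntegrable 1] with x hx hxA
    have h1 := hx (l := nhdsWithin 0 (Ioi 0)) (fun _ => x) (fun t : ℝ => t) Filter.tendsto_id
      (by filter_upwards [self_mem_nhdsWithin] with t ht
          have : (0:ℝ) < t := ht
          simp [this.le])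
    have h2 := h1.eventually (lt_mem_nhds hxA.1)
    obtain ⟨r, hr, hr0⟩ := (h2.and self_mem_nhdsWithin).exists
    have hr0 : 0 < r := hr0
    refine ⟨r, hr0, ?_⟩
    rwa [setAverage_eq, vol_cb n x hr0.le, smul_eq_mul, inv_mul_eq_div, lt_div_iff₀ (by positivity)] at hr
  have hch : ∀ y, (S y).Nonempty → ∃ r ∈ S y, ∀ ρ, 2 * r ≤ ρ → ∫ z in closedBall y ρ, f z ≤ l * (ρ^n * v) := by
    intro y hy
    have hb : BddAbove (S y) := ⟨1, hS1 y⟩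
    have hpos : 0 < sSup (S y) := by
      obtain ⟨r, hr⟩ := hy
      exact hr.1.trans_le (le_csSup hb hr)
    obtain ⟨r, hr, hr2⟩ := exists_lt_of_lt_csSup hy (half_lt_self hpos)
    refine ⟨r, hr, fun ρ hρ => ?_⟩
    by_contra! hcon
    have : ρ ∈ S y := ⟨by linarith [hr.1], hcon⟩
    have := le_csSup hb this
    linarith
  choose! r hrS hr2 using hch
  set t : Set (En n) := {y | y ∈ A ∧ (S y).Nonempty} with ht
  obtain ⟨u, hut, hdis, hcov⟩ := Vitali.exists_disjoint_subfamily_covering_enlargement_closedBall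
    t (fun y => y) r 1 (fun y hy => hS1 y _ (hrS y hy.2)) 5 (by norm_num)
  have hrpos : ∀ y ∈ t, 0 < r y := fun y hy => (hrS y hy.2).1
  have hcount : u.Countable := by
    apply hdis.countable_of_nonempty_interior
    intro y hy
    exact ⟨y, ball_subset_interior_closedBall (mem_ball_self (hrpos y (hut hy)))⟩
  have := hcount.to_subtype
  refine ⟨⋃ y ∈ u, closedBall y (r y), MeasurableSet.biUnion hcount fun _ _ => measurableSet_closedBall, ?_, ?_⟩
  · rw [measure_biUnion hcount hdis fun _ _ => measurableSet_closedBall, ← ENNReal.tsum_mul_left]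
    calc ∫⁻ y in A, ENNReal.ofReal (f y) ≤ ∫⁻ y in ⋃ b : u, closedBall (b : En n) (5 * r b), ENNReal.ofReal (f y) := by
          apply lintegral_mono_set'
          filter_upwards [hgood] with y hy hyA
          obtain ⟨b, hb, hsub⟩ := hcov y ⟨hyA, hy hyA⟩
          exact mem_iUnion.2 ⟨⟨b, hb⟩, hsub (mem_closedBall_self (hrpos y ⟨hyA, hy hyA⟩).le)⟩
      _ ≤ ∑' b : u, ∫⁻ y in closedBall (b : En n) (5 * r b), ENNReal.ofReal (f y) := lintegral_iUnion_le _ _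
      _ ≤ _ := by
          apply ENNReal.tsum_le_tsum
          intro b
          have hb := hrpos b (hut b.2)
          rw [← ofReal_integral_eq_lintegral_ofReal hf.integrableOn (Filter.Eventually.of_forall hf0)]
          rw [← ofReal_measureReal (measure_closedBall_lt_top.ne), ← ENNReal.ofReal_mul (by positivity)]
          apply ENNReal.ofReal_le_ofReal
          refine (hr2 b (hut b.2).2 _ (by linarith)).trans (le_of_eq ?_)
          rw [vol_cb n _ hb.le, ← hv, mul_pow]; ring
  · intro x hx
    simp only [mem_iUnion] at hx
    obtain ⟨y, hy, hxy⟩ := hx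
    have hyt := hut hy
    refine ⟨?_, r y, hrpos y hyt, y, hxy, (hrS y hyt.2).2.le⟩
    have h1 := hS1 y _ (hrS y hyt.2)
    have h2 : ‖x - y‖ ≤ r y := by rwa [mem_closedBall, dist_eq_norm] at hxy
    have h3 : ‖x‖ ≤ ‖x - y‖ + ‖y‖ := by simpa using norm_add_le (x - y) y
    have h4 := hyt.1.2
    linarith

lemma phiConv_sub {n : ℕ} {φ : En n → ℝ} {a : ℝ} (h : GoodPhi n φ a) {f θ : En n → ℝ}
    (hf : Integrable f) (hθ : Integrable θ) (c t : ℝ) (x : En n) :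
    phiConv n φ (fun y => f y - c * θ y) t x = phiConv n φ f t x - c * phiConv n φ θ t x := by
  simp only [phiConv_eq]
  have : ∀ y, φ (t⁻¹ • (x - y)) * (f y - c * θ y) =
      φ (t⁻¹ • (x - y)) * f y - c * (φ (t⁻¹ • (x - y)) * θ y) := fun y => by ring
  simp only [this]
  rw [integral_sub (h.integrable hf t x) ((h.integrable hθ t x).const_mul c), integral_const_mul]
  ring

lemma lowB {n : ℕ} {φ : En n → ℝ} {a : ℝ} (h : GoodPhi n φ a) {f θ : En n → ℝ}
    (hf : Integrable f) (hf0 : ∀ x, 0 ≤ f x) (hθ : Integrable θ) {C c l r : ℝ} (hc : 0 ≤ c)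
    (hC : ∀ x, |θ x| ≤ C) (hr : 0 < r) {x y : En n} (hxy : x ∈ closedBall y r)
    (hl : l * (r^n * volume.real (ball (0 : En n) 1)) ≤ ∫ z in closedBall y r, f z) :
    a * volume.real (ball (0 : En n) 1) * (4^n)⁻¹ * l - c * (a * C * volume.real (ball (0 : En n) 1)) ≤
      |phiConv n φ (fun y => f y - c * θ y) (4 * r) x| := by
  have ha := h.pos
  set v := volume.real (ball (0 : En n) 1) with hv
  have hvp : 0 < v := v_pos n
  rw [phiConv_sub h hf hθ]
  refine le_trans ?_ (le_abs_self _)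
  apply sub_le_sub
  · rw [phiConv_eq]
    have h1 : a * ∫ z in closedBall y r, f z ≤ ∫ z, φ ((4 * r)⁻¹ • (x - z)) * f z := by
      rw [← integral_const_mul]
      calc ∫ z in closedBall y r, a * f z = ∫ z in closedBall y r, φ ((4 * r)⁻¹ • (x - z)) * f z := by
            apply setIntegral_congr_fun measurableSet_closedBall
            intro z hz
            simp only
            rw [h.eq]
            rw [norm_smul, norm_inv, Real.norm_eq_abs, abs_of_pos (by positivity), inv_mul_eq_div,
              div_le_iff₀ (by positivity)]
            rw [← dist_eq_norm]
            rw [mem_closedBall] at hz hxy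
            have := dist_triangle_right x z y
            linarith
        _ ≤ _ := setIntegral_le_integral (h.integrable hf _ _)
            (Filter.Eventually.of_forall fun z => mul_nonneg (h.nonneg _) (hf0 z))
    calc a * v * (4^n)⁻¹ * l = ((4 * r)^n)⁻¹ * (a * (l * (r^n * v))) := by
          rw [mul_pow]; field_simp
      _ ≤ _ := by
          gcongr
          exact (mul_le_mul_of_nonneg_left hl ha.le).trans h1
  · apply mul_le_mul_of_nonneg_left _ hc
    refine (le_abs_self _).trans ((h.abs_le hθ (by positivity) x).trans ?_)
    have h1 : ∫ y in closedBall x (4 * r), |θ y| ≤ C * ((4 * r)^n * v) := by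
      rw [hv, ← vol_cb n x (by positivity)]
      have := norm_setIntegral_le_of_norm_le_const (f := fun y => |θ y|) (C := C) (μ := volume) (s := closedBall x (4*r))
        measure_closedBall_lt_top (fun y _ => by simpa using hC y)
      exact (le_abs_self _).trans this
    calc _ ≤ ((4 * r)^n)⁻¹ * (a * (C * ((4 * r)^n * v))) := by gcongr
      _ = _ := by field_simp

lemma norm_le_of_unitQ {n : ℕ} {y : En n} (hy : y ∈ unitQ n) : ‖y‖ ≤ n := by
  rw [EuclideanSpace.norm_eq]
  apply Real.sqrt_le_iff.2 ⟨by positivity, ?_⟩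
  have h1 : ∑ i, ‖y i‖^2 ≤ ∑ i : Fin n, (1:ℝ) := by
    apply Finset.sum_le_sum
    intro i _
    have := hy i
    rw [Real.norm_eq_abs, sq_abs]
    nlinarith
  refine h1.trans ?_
  simp
  exact_mod_cast Nat.le_self_pow (by norm_num) n

lemma lowA {n : ℕ} {φ : En n → ℝ} {a : ℝ} (h : GoodPhi n φ a) {f θ : En n → ℝ}
    (hf : Integrable f) (hf0 : ∀ x, 0 ≤ f x) (hθ : Integrable θ)
    (hθsupp : ∀ x, x ∉ unitQ n → θ x = 0) (hθint : (∫ x, θ x) = 1) {p : ℕ} (hp : n ≤ p)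
    {x : En n} (hx : ‖x‖ ≤ 2^(p+1)) :
    ((2^(p+3))^n)⁻¹ * (a * ∫ y in {y | (2:ℝ)^(p+4) < ‖y‖}, f y) ≤
      |phiConv n φ (fun y => f y - (∫ z, f z) * θ y) (2^(p+3)) x| := by
  have ha := h.pos
  have hp1 : (n:ℝ) ≤ 2^(p+1) := by
    have : n ≤ 2^(p+1) := (Nat.lt_two_pow_self (n := n)).le.trans (Nat.pow_le_pow_right (by norm_num) (by omega))
    exact_mod_cast this
  have e1 : (2:ℝ)^(p+3) = 4 * 2^(p+1) := by ring
  have e2 : (2:ℝ)^(p+4) = 8 * 2^(p+1) := by ring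
  have e3 : (0:ℝ) < 2^(p+1) := by positivity
  have hset : MeasurableSet {y : En n | (2:ℝ)^(p+4) < ‖y‖} := measurableSet_lt (by fun_prop) (by fun_prop)
  rw [phiConv_sub h hf hθ]
  rw [phiConv_eq, phiConv_eq]
  have hθ1 : ∫ y, φ (((2:ℝ)^(p+3))⁻¹ • (x - y)) * θ y = a := by
    have : ∀ y, φ (((2:ℝ)^(p+3))⁻¹ • (x - y)) * θ y = a * θ y := by
      intro y
      by_cases hy : y ∈ unitQ n
      · rw [h.eq]
        rw [norm_smul, norm_inv, Real.norm_eq_abs, abs_of_pos (by positivity), inv_mul_eq_div,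
              div_le_iff₀ (by positivity)]
        have := norm_sub_le x y
        have := norm_le_of_unitQ hy
        linarith
      · rw [hθsupp y hy]; simp
    simp only [this]
    rw [integral_const_mul, hθint, mul_one]
  rw [hθ1]
  have hI := h.integrable hf (2^(p+3)) x
  have key : a * ∫ y in {y | (2:ℝ)^(p+4) < ‖y‖}, f y ≤
      a * (∫ y, f y) - ∫ y, φ (((2:ℝ)^(p+3))⁻¹ • (x - y)) * f y := by
    rw [← integral_const_mul, ← integral_const_mul, ← integral_sub (hf.const_mul a) hI]
    rw [← integral_indicator hset]
    apply integral_mono ((hf.const_mul a).indicator hset) ((hf.const_mul a).sub hI)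
    intro y
    by_cases hy : y ∈ {y : En n | (2:ℝ)^(p+4) < ‖y‖}
    · rw [indicator_of_mem hy]
      simp only [Pi.sub_apply]
      rw [h.zero]
      · simp
      · rw [norm_smul, norm_inv, Real.norm_eq_abs, abs_of_pos (by positivity), inv_mul_eq_div,
              one_lt_div (by positivity)]
        have h1 : ‖y‖ ≤ ‖x‖ + ‖x - y‖ := by simpa using norm_sub_le x (x - y)
        have h2 : (2:ℝ)^(p+4) < ‖y‖ := hy
        linarith
    · rw [indicator_of_notMem hy]
      simp only [Pi.sub_apply]
      have := mul_le_mul_of_nonneg_right (h.le (((2:ℝ)^(p+3))⁻¹ • (x - y))) (hf0 y)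
      linarith
  refine le_trans ?_ (neg_le_abs _)
  have := mul_le_mul_of_nonneg_left key (by positivity : 0 ≤ (((2:ℝ)^(p+3))^n)⁻¹)
  linarith

lemma lint_W {n : ℕ} {f : En n → ℝ} (hf : Integrable f) (P : ℕ → Set (En n))
    (hP : ∀ k, NullMeasurableSet (P k)) (w : ℕ → ℝ≥0∞) [∀ k y, Decidable (y ∈ P k)] :
    ∫⁻ y, ENNReal.ofReal (f y) * ∑' k, (if y ∈ P k then w k else 0) =
      ∑' k, w k * ∫⁻ y in P k, ENNReal.ofReal (f y) := by
  have hm : AEMeasurable (fun y => ENNReal.ofReal (f y)) := hf.aestronglyMeasurable.aemeasurable.ennreal_ofReal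
  have e : ∀ k y, ENNReal.ofReal (f y) * (if y ∈ P k then w k else 0) =
      (P k).indicator (fun y => w k * ENNReal.ofReal (f y)) y := by
    intro k y
    by_cases hy : y ∈ P k
    · simp [hy, mul_comm]
    · simp [hy]
  simp_rw [← ENNReal.tsum_mul_left, e]
  rw [lintegral_tsum]
  · congr with k
    rw [lintegral_indicator₀ (hP k), lintegral_const_mul'' _ hm.restrict]
  · intro k
    exact (hm.const_mul _).indicator₀ (hP k)

lemma partA {n : ℕ} (hn : 1 ≤ n) {φ : En n → ℝ} {a : ℝ} (h : GoodPhi n φ a) {f θ : En n → ℝ}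
    (hf : Integrable f) (hf0 : ∀ x, 0 ≤ f x) (hθ : Integrable θ)
    (hθsupp : ∀ x, x ∉ unitQ n → θ x = 0) (hθint : (∫ x, θ x) = 1)
    (hH : ∫⁻ x, ENNReal.ofReal
        (Psi n x (Mphi n φ (fun y => f y - (∫ z, f z) * θ y) x)) < ⊤) :
    ∫⁻ y, ENNReal.ofReal (f y) * Wsum (n+4) ‖y‖ < ⊤ := by
  classical
  have ha := h.pos
  set v := volume.real (ball (0 : En n) 1) with hv
  have hvp : 0 < v := v_pos n
  set c := ∫ z, f z with hc
  have hc0 : 0 ≤ c := integral_nonneg hf0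
  set G : En n → ℝ≥0∞ := fun x => ENNReal.ofReal (Psi n x (Mphi n φ (fun y => f y - c * θ y) x)) with hG
  let P : ℕ → Set (En n) := fun k => {y | (2:ℝ)^(k+(n+4)) < ‖y‖}
  have hP : ∀ k, MeasurableSet (P k) := fun k => measurableSet_lt (by fun_prop) (by fun_prop)
  set B : ℝ := Real.log (Real.exp 1 + a * c) + n + 3 with hB
  have hL := aux_one_le_log (mul_nonneg ha.le hc0)
  have hBp : 0 < B := by positivity
  set κ : ℝ := a * v * (32^n)⁻¹ / B with hκ
  have hκp : 0 < κ := by positivity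
  let e : En n := EuclideanSpace.single ⟨0, hn⟩ 1
  have he : ‖e‖ = 1 := by simp [e]
  let D : ℕ → Set (En n) := fun k => closedBall ((3/2 * (2:ℝ)^(k+n)) • e) (2^(k+n)/4)
  have hDn : ∀ k, ∀ x ∈ D k, (2:ℝ)^(k+n) < ‖x‖ ∧ ‖x‖ < 2^(k+n+1) := by
    intro k x hx
    have hp : (0:ℝ) < 2^(k+n) := by positivity
    have h1 : ‖x - (3/2 * (2:ℝ)^(k+n)) • e‖ ≤ 2^(k+n)/4 := by
      simpa [D, dist_eq_norm] using hx
    have h2 : ‖(3/2 * (2:ℝ)^(k+n)) • e‖ = 3/2 * (2:ℝ)^(k+n) := by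
      rw [norm_smul, he, Real.norm_eq_abs, abs_of_pos (by positivity), mul_one]
    have h3 := abs_le.1 ((abs_norm_sub_norm_le x ((3/2 * (2:ℝ)^(k+n)) • e)).trans h1)
    rw [h2] at h3
    rw [pow_succ]
    constructor <;> linarith [h3.1, h3.2]
  have hdis : Pairwise (Function.onFun Disjoint D) := by
    have key : ∀ i j, i < j → Disjoint (D i) (D j) := by
      intro i j hij
      rw [Set.disjoint_left]
      intro x hi hj
      have h1 := (hDn i x hi).2
      have h2 := (hDn j x hj).1
      have h3 : (2:ℝ)^(i+n+1) ≤ 2^(j+n) := pow_le_pow_right₀ (by norm_num) (by omega)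
      linarith
    intro i j hij
    rcases lt_or_gt_of_ne hij with h | h
    · exact key i j h
    · exact (key j i h).symm
  have hg : Integrable (fun y => f y - c * θ y) := hf.sub (hθ.const_mul c)
  have step : ∀ k : ℕ, ENNReal.ofReal κ * (ENNReal.ofReal (1/((k:ℝ)+1)) * ∫⁻ y in P k, ENNReal.ofReal (f y)) ≤
      ∫⁻ x in D k, G x := by
    intro k
    rw [← ofReal_integral_eq_lintegral_ofReal hf.integrableOn (Filter.Eventually.of_forall hf0)]
    set F := ∫ y in P k, f y with hF
    have hF0 : 0 ≤ F := integral_nonneg hf0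
    have hFc : F ≤ c := setIntegral_le_integral hf (Filter.Eventually.of_forall hf0)
    set m : ℝ := ((2^(k+n+3))^n)⁻¹ * (a * F) with hm
    have hm0 : 0 ≤ m := by positivity
    have hmc : m ≤ a * c := by
      have : (((2:ℝ)^(k+n+3))^n)⁻¹ ≤ 1 := inv_le_one_of_one_le₀ (one_le_pow₀ (one_le_pow₀ (by norm_num)))
      calc m ≤ 1 * (a * F) := by rw [hm]; gcongr
        _ ≤ a * c := by rw [one_mul]; gcongr
    have hle : ∀ᵐ x ∂(volume.restrict (D k)), ENNReal.ofReal (m / (B * (k+1))) ≤ G x := by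
      filter_upwards [ae_restrict_of_ae (h.bdd hg), ae_restrict_mem measurableSet_closedBall] with x hbd hx
      apply ENNReal.ofReal_le_ofReal
      have hx2 := (hDn k x hx).2
      have h1 := lowA h hf hf0 hθ hθsupp hθint (p := k+n) (by omega) hx2.le
      have h2 : m ≤ Mphi n φ (fun y => f y - c * θ y) x :=
        le_trans h1 (le_ciSup hbd ⟨2^(k+n+3), by positivity⟩)
      refine le_trans ?_ (aux_psi_mono n x hm0 h2)
      unfold Psi
      have h3 := aux_one_le_log hm0
      have h4 := aux_one_le_log (norm_nonneg x)
      have h5 : Real.log (Real.exp 1 + m) ≤ Real.log (Real.exp 1 + a * c) :=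
        Real.log_le_log (by positivity) (by linarith)
      have h6 : Real.log (Real.exp 1 + ‖x‖) ≤ Real.log (Real.exp 1 + 2^(k+n+1)) :=
        Real.log_le_log (by positivity) (by linarith)
      have h7 := aux_log_pow (k+n+1)
      push_cast at h7
      apply div_le_div_of_nonneg_left hm0 (by linarith)
      have hk : (0:ℝ) ≤ k := by positivity
      have hnn : (0:ℝ) ≤ n := by positivity
      nlinarith [mul_nonneg hk (by linarith : 0 ≤ B - 1)]
    calc _ = ENNReal.ofReal (m / (B * (k+1))) * volume (D k) := by
          rw [← ofReal_measureReal (measure_closedBall_lt_top.ne), vol_cb n _ (by positivity),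
            ← ENNReal.ofReal_mul (by positivity), ← ENNReal.ofReal_mul (by positivity), ← ENNReal.ofReal_mul (by positivity)]
          congr 1
          rw [hκ, hm, ← hv]
          have e1 : ((2:ℝ)^(k+n+3))^n = (2^(k+n))^n * 8^n := by rw [pow_add, mul_pow]; norm_num
          have e2 : (32:ℝ)^n = 8^n * 4^n := by rw [← mul_pow]; norm_num
          rw [e1, e2, div_pow]
          field_simp
      _ = ∫⁻ x in D k, ENNReal.ofReal (m / (B * (k+1))) := by rw [setLIntegral_const]
      _ ≤ _ := lintegral_mono_ae hle
  have hsum : ENNReal.ofReal κ * ∫⁻ y, ENNReal.ofReal (f y) * Wsum (n+4) ‖y‖ ≤ ∫⁻ x, G x := by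
    have := lint_W hf P (fun k => (hP k).nullMeasurableSet) (fun k => ENNReal.ofReal (1/((k:ℝ)+1)))
    have e2 : ∫⁻ y, ENNReal.ofReal (f y) * Wsum (n+4) ‖y‖ = ∑' k : ℕ, ENNReal.ofReal (1/((k:ℝ)+1)) * ∫⁻ y in P k, ENNReal.ofReal (f y) := by
      rw [← this]; simp only [Wsum, P, mem_ofPred_eq]
    rw [e2, ← ENNReal.tsum_mul_left]
    calc _ ≤ ∑' k, ∫⁻ x in D k, G x := ENNReal.tsum_le_tsum step
      _ = ∫⁻ x in ⋃ k, D k, G x := (lintegral_iUnion (fun _ => measurableSet_closedBall) hdis _).symm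
      _ ≤ _ := setLIntegral_le_lintegral _ _
  by_contra hcon
  rw [not_lt, top_le_iff] at hcon
  rw [hcon, ENNReal.mul_top (by simpa using hκp)] at hsum
  exact absurd hH (not_lt.2 hsum)

lemma partB {n : ℕ} {φ : En n → ℝ} {a : ℝ} (h : GoodPhi n φ a) {f θ : En n → ℝ}
    (hf : Integrable f) (hf0 : ∀ x, 0 ≤ f x) (hθ : Integrable θ) {C : ℝ} (hC : ∀ x, |θ x| ≤ C)
    (hH : ∫⁻ x, ENNReal.ofReal
        (Psi n x (Mphi n φ (fun y => f y - (∫ z, f z) * θ y) x)) < ⊤) :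
    ∃ N0 : ℕ, ∀ N ≥ N0, ∫⁻ y, ENNReal.ofReal (f y) *
      ∑' k : ℕ, (if (2:ℝ)^(k+N) < f y ∧ 2 + ‖y‖ < (2:ℝ)^(k+N) then ENNReal.ofReal (1/((k:ℝ)+1)) else 0) < ⊤ := by
  classical
  have ha := h.pos
  set v := volume.real (ball (0 : En n) 1) with hv
  have hvp : 0 < v := v_pos n
  set c := ∫ z, f z with hc
  have hc0 : 0 ≤ c := integral_nonneg hf0
  set G : En n → ℝ≥0∞ := fun x => ENNReal.ofReal (Psi n x (Mphi n φ (fun y => f y - c * θ y) x)) with hG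
  set b : ℝ := a * v * (4^n)⁻¹ with hb
  have hbp : 0 < b := by positivity
  obtain ⟨N0, hN0⟩ := pow_unbounded_of_one_lt (max (c / v) (2 * (c * (a * C * v)) / b)) (one_lt_two (α := ℝ))
  refine ⟨N0, fun N hN => ?_⟩
  have hbig : ∀ k, c < (2:ℝ)^(k+N) * v ∧ c * (a * C * v) ≤ b * 2^(k+N) / 2 := by
    intro k
    have h1 : (2:ℝ)^N0 ≤ 2^(k+N) := pow_le_pow_right₀ (by norm_num) (by omega)
    have h2 := (le_max_left _ _).trans_lt (hN0.trans_le h1)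
    have h3 := (le_max_right _ _).trans_lt (hN0.trans_le h1)
    rw [div_lt_iff₀ (by positivity)] at h2 h3
    exact ⟨h2, by linarith⟩
  have hg : Integrable (fun y => f y - c * θ y) := hf.sub (hθ.const_mul c)
  choose E hEm hE1 hE2 using fun k : ℕ => stop_lemma hf hf0 (l := 2^(k+N)) (by positivity) (hbig k).1
  -- min of b/2 and 1
  set d : ℝ := min (b/2) 1 with hd
  have hdp : 0 < d := by positivity
  have hd1 : d ≤ 1 := min_le_right _ _
  have hpt : ∀ᵐ x : En n, ∀ k, x ∈ E k → ‖x‖ ≤ 2^(k+N) ∧ d * 2^(k+N) ≤ Mphi n φ (fun y => f y - c * θ y) x := by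
    filter_upwards [h.bdd hg] with x hbd k hx
    obtain ⟨h1, r, hr, y, hxy, hl⟩ := hE2 k x hx
    refine ⟨h1, ?_⟩
    have h2 := lowB h hf hf0 hθ hc0 hC hr hxy hl
    have h3 := (hbig k).2
    have h4 : |phiConv n φ (fun y => f y - c * θ y) (4*r) x| ≤ _ := le_ciSup hbd ⟨4 * r, by positivity⟩
    refine le_trans ?_ (h2.trans h4)
    rw [← hv, ← hb]
    have h5 : d * 2^(k+N) ≤ b/2 * 2^(k+N) := by gcongr; exact min_le_left _ _
    linarith
  -- pointwise sum bound
  set Q : ℝ := 4 * (2 * (N + 2)) / d with hQ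
  have hQp : 0 < Q := by positivity
  have hsum : ∀ᵐ x : En n, ∑' k : ℕ, (E k).indicator (fun _ => ENNReal.ofReal ((2:ℝ)^(k+N) / (k+1))) x ≤
      ENNReal.ofReal Q * G x := by
    filter_upwards [hpt] with x hx
    apply ENNReal.tsum_le_of_sum_range_le
    intro m
    induction m with
    | zero => simp
    | succ m ih =>
      by_cases hm : x ∈ E m
      · obtain ⟨h1, h2⟩ := hx m hm
        calc _ ≤ ∑ k ∈ Finset.range (m+1), ENNReal.ofReal ((2:ℝ)^(k+N) / (k+1)) :=
              Finset.sum_le_sum fun k _ => indicator_le_self (E k) (fun _ => ENNReal.ofReal ((2:ℝ)^(k+N) / (k+1))) x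
          _ = ENNReal.ofReal (∑ k ∈ Finset.range (m+1), (2:ℝ)^(k+N) / (k+1)) := by
              rw [ENNReal.ofReal_sum_of_nonneg (fun k _ => by positivity)]
          _ ≤ ENNReal.ofReal Q * G x := by
              rw [hG, ← ENNReal.ofReal_mul hQp.le]
              apply ENNReal.ofReal_le_ofReal
              have h3 := aux_psi_mono n x (s := d * 2^(m+N)) (by positivity) h2
              refine le_trans ?_ (mul_le_mul_of_nonneg_left h3 hQp.le)
              have h4 : ∑ k ∈ Finset.range (m+1), (2:ℝ)^(k+N) / (k+1) ≤ 4 * 2^(m+N) / (m+1) := by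
                have := mul_le_mul_of_nonneg_left (aux_geom m) (by positivity : (0:ℝ) ≤ 2^N)
                rw [Finset.mul_sum] at this
                calc _ = _ := Finset.sum_congr rfl fun k _ => by rw [pow_add]; ring
                  _ ≤ _ := this
                  _ = _ := by rw [pow_add]; ring
              refine h4.trans ?_
              unfold Psi
              have h5 := aux_log_pow (m+N)
              have h6 : Real.log (Real.exp 1 + d * 2^(m+N)) ≤ Real.log (Real.exp 1 + 2^(m+N)) := by
                apply Real.log_le_log (by positivity)
                have : d * (2:ℝ)^(m+N) ≤ 1 * 2^(m+N) := by gcongr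
                linarith
              have h7 : Real.log (Real.exp 1 + ‖x‖) ≤ Real.log (Real.exp 1 + 2^(m+N)) :=
                Real.log_le_log (by positivity) (by linarith)
              have h8 := aux_one_le_log (by positivity : 0 ≤ d * (2:ℝ)^(m+N))
              have h9 := aux_one_le_log (norm_nonneg x)
              push_cast at h5
              have hk : (0:ℝ) ≤ m := by positivity
              have hnn : (0:ℝ) ≤ N := by positivity
              have h10 : Real.log (Real.exp 1 + d * 2^(m+N)) + Real.log (Real.exp 1 + ‖x‖) ≤ 2 * (N+2) * (m+1) := by
                nlinarith [mul_nonneg hk hnn]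
              have h11 : d * 2^(m+N) / (2 * (N+2) * (m+1)) ≤ d * 2^(m+N) / (Real.log (Real.exp 1 + d * 2^(m+N)) + Real.log (Real.exp 1 + ‖x‖)) :=
                div_le_div_of_nonneg_left (by positivity) (by linarith) h10
              refine le_trans (le_of_eq ?_) (mul_le_mul_of_nonneg_left h11 hQp.le)
              rw [hQ]
              field_simp
      · rw [Finset.sum_range_succ, indicator_of_notMem hm, add_zero]
        exact ih
  let P : ℕ → Set (En n) := fun k => {y | (2:ℝ)^(k+N) < f y ∧ 2 + ‖y‖ < (2:ℝ)^(k+N)}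
  have hP : ∀ k, NullMeasurableSet (P k) := fun k =>
    (nullMeasurableSet_lt aemeasurable_const hf.aestronglyMeasurable.aemeasurable).inter
      (measurableSet_lt (f := fun y : En n => 2 + ‖y‖) (g := fun _ => (2:ℝ)^(k+N)) (by fun_prop) (by fun_prop)).nullMeasurableSet
  have hfin : ∫⁻ x, ENNReal.ofReal Q * G x < ⊤ := by
    rw [lintegral_const_mul' _ _ ENNReal.ofReal_ne_top]
    exact ENNReal.mul_lt_top ENNReal.ofReal_lt_top hH
  have e2 := lint_W hf P hP (fun k => ENNReal.ofReal (1/((k:ℝ)+1)))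
  simp only [P, mem_ofPred_eq] at e2
  rw [e2]
  calc _ ≤ ∑' k : ℕ, ENNReal.ofReal (5^n) * ∫⁻ x, (E k).indicator (fun _ => ENNReal.ofReal ((2:ℝ)^(k+N) / (k+1))) x := by
        apply ENNReal.tsum_le_tsum
        intro k
        rw [lintegral_indicator_const (hEm k), ← mul_assoc, ← ENNReal.ofReal_mul (by positivity)]
        refine (mul_le_mul_right (hE1 k) _).trans (le_of_eq ?_)
        rw [← mul_assoc, ← ENNReal.ofReal_mul (by positivity)]
        congr 2
        ring
    _ = ENNReal.ofReal (5^n) * ∫⁻ x, ∑' k : ℕ, (E k).indicator (fun _ => ENNReal.ofReal ((2:ℝ)^(k+N) / (k+1))) x := by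
        rw [ENNReal.tsum_mul_left, lintegral_tsum]
        intro k
        exact (measurable_const.indicator (hEm k)).aemeasurable
    _ ≤ ENNReal.ofReal (5^n) * ∫⁻ x, ENNReal.ofReal Q * G x := by
        exact mul_le_mul_right (lintegral_mono_ae hsum) _
    _ < ⊤ := ENNReal.mul_lt_top ENNReal.ofReal_lt_top hfin

/-- **Necessity in the global Stein theorem for `H_log`.**
If `f` is nonnegative integrable and `T_θ f = f - (∫ f) θ` belongs to
`H_log(ℝ^n)`, then `∫ f (1 + ln₊ ln(e+f) + ln₊ ln(e+|x|)) dx < ∞`. -/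
theorem global_stein_Hlog_necessity (n : ℕ) (hn : 1 ≤ n) (θ f : En n → ℝ)
    (hθmeas : Measurable θ) (hθbdd : ∃ C, ∀ x, |θ x| ≤ C)
    (hθsupp : ∀ x, x ∉ unitQ n → θ x = 0) (hθint : (∫ x, θ x) = 1)
    (hf : Integrable f) (hf0 : ∀ x, 0 ≤ f x)
    (hHlog : ∀ φ : En n → ℝ, IsTestFun n φ →
      ∫⁻ x, ENNReal.ofReal
        (Psi n x (Mphi n φ (fun y => f y - (∫ z, f z) * θ y) x)) < ⊤) :
    ∫⁻ x, ENNReal.ofReal (f x *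
      (1 + lnp (Real.log (Real.exp 1 + f x)) +
        lnp (Real.log (Real.exp 1 + ‖x‖)))) < ⊤ := by
  obtain ⟨C, hC⟩ := hθbdd
  have hθ : Integrable θ := by
    by_contra hcon
    rw [integral_undef hcon] at hθint
    exact zero_ne_one hθint
  obtain ⟨φ, a, h⟩ := exists_good n
  have hH := hHlog φ h.test
  have hA := partA hn h hf hf0 hθ hθsupp hθint hH
  obtain ⟨N0, hB⟩ := partB h hf hf0 hθ hC hH
  set M := N0 + n + 4 with hM
  have hB := hB (M + 2) (by omega)
  set WB : En n → ℝ≥0∞ := fun y => ∑' k : ℕ, (if (2:ℝ)^(k+(M+2)) < f y ∧ 2 + ‖y‖ < (2:ℝ)^(k+(M+2)) then ENNReal.ofReal (1/((k:ℝ)+1)) else 0) with hWB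
  have hmono : ∀ (N N' : ℕ) (s : ℝ), N ≤ N' → Wsum N' s ≤ Wsum N s := by
    intro N N' s hNN
    unfold Wsum
    apply ENNReal.tsum_le_tsum
    intro k
    by_cases hk : (2:ℝ)^(k+N') < s
    · have : (2:ℝ)^(k+N) < s := lt_of_le_of_lt (pow_le_pow_right₀ (by norm_num) (by omega)) hk
      rw [if_pos hk, if_pos this]
    · rw [if_neg hk]; exact zero_le
  have hsplit : ∀ y, Wsum (M+2) (f y) ≤ WB y + Wsum (n+4) ‖y‖ := by
    intro y
    refine le_trans ?_ (add_le_add_right (hmono (n+4) M ‖y‖ (by omega)) _)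
    unfold Wsum
    rw [hWB, ← ENNReal.tsum_add]
    apply ENNReal.tsum_le_tsum
    intro k
    by_cases h1 : (2:ℝ)^(k+(M+2)) < f y
    · by_cases h2 : 2 + ‖y‖ < (2:ℝ)^(k+(M+2))
      · rw [if_pos h1, if_pos ⟨h1, h2⟩]; exact le_self_add
      · have h3 : (2:ℝ)^(k+M) < ‖y‖ := by
          have e1 : (2:ℝ)^(k+(M+2)) = 4 * 2^(k+M) := by ring
          have e2 : (1:ℝ) ≤ 2^(k+M) := one_le_pow₀ (by norm_num)
          push Not at h2
          linarith
        rw [if_pos h1, if_pos h3]; exact le_add_self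
    · rw [if_neg h1]; exact zero_le
  set R : ℝ≥0∞ := 1 + ENNReal.ofReal (Real.log ((M+2 : ℕ)+2)) + ENNReal.ofReal (Real.log ((n+4 : ℕ)+2)) with hR
  have hRtop : R ≠ ⊤ := by rw [hR]; simp
  have hm : AEMeasurable (fun y => ENNReal.ofReal (f y)) := hf.aestronglyMeasurable.aemeasurable.ennreal_ofReal
  have hWm : Measurable (fun y : En n => Wsum (n+4) ‖y‖) := by
    unfold Wsum
    refine Measurable.tsum fun k => ?_
    exact Measurable.ite (measurableSet_lt (by fun_prop) (by fun_prop)) measurable_const measurable_const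
  have hpt : ∀ y, ENNReal.ofReal (f y * (1 + lnp (Real.log (Real.exp 1 + f y)) +
        lnp (Real.log (Real.exp 1 + ‖y‖)))) ≤
      ENNReal.ofReal (f y) * R + 2 * (ENNReal.ofReal (f y) * Wsum (n+4) ‖y‖) + ENNReal.ofReal (f y) * WB y := by
    intro y
    have l1 : 0 ≤ lnp (Real.log (Real.exp 1 + f y)) := le_max_right _ _
    have l2 : 0 ≤ lnp (Real.log (Real.exp 1 + ‖y‖)) := le_max_right _ _
    rw [ENNReal.ofReal_mul (hf0 y), ENNReal.ofReal_add (by positivity) l2, ENNReal.ofReal_add (by positivity) l1,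
      ENNReal.ofReal_one]
    have h1 := (aux_loglog (M+2) (f y) (hf0 y)).trans (add_le_add_right (hsplit y) _)
    have h2 := aux_loglog (n+4) ‖y‖ (norm_nonneg y)
    calc _ ≤ ENNReal.ofReal (f y) * (1 + (ENNReal.ofReal (Real.log ((M+2 : ℕ)+2)) + (WB y + Wsum (n+4) ‖y‖)) + (ENNReal.ofReal (Real.log ((n+4 : ℕ)+2)) + Wsum (n+4) ‖y‖)) := by
          gcongr
      _ = _ := by rw [hR]; ring
  refine lt_of_le_of_lt (lintegral_mono hpt) ?_
  have hf1 : ∫⁻ y, ENNReal.ofReal (f y) * R < ⊤ := by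
    rw [lintegral_mul_const' _ _ hRtop]
    refine ENNReal.mul_lt_top ?_ hRtop.lt_top
    rw [← ofReal_integral_eq_lintegral_ofReal hf (Filter.Eventually.of_forall hf0)]
    exact ENNReal.ofReal_lt_top
  have hf2 : AEMeasurable (fun y => 2 * (ENNReal.ofReal (f y) * Wsum (n+4) ‖y‖)) :=
    (hm.mul hWm.aemeasurable).const_mul _
  have hf3 : AEMeasurable (fun y => ENNReal.ofReal (f y) * R + 2 * (ENNReal.ofReal (f y) * Wsum (n+4) ‖y‖)) :=
    (hm.mul_const _).add hf2
  rw [lintegral_add_left' hf3, lintegral_add_left' (hm.mul_const _),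
    lintegral_const_mul' _ _ (by norm_num)]
  exact ENNReal.add_lt_top.2 ⟨ENNReal.add_lt_top.2 ⟨hf1, ENNReal.mul_lt_top (by norm_num) hA⟩, hB⟩
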